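/- arXiv:2504.17217 — 2 statements merged into one kernel-verified Lean document; each statement's English description precedes it below -/
import Mathlib

section
/- Let R be a Noetherian ring, 𝔞 an ideal of R, and M a finitely generated R-module with cd(𝔞, M) ≥ 1. Then the local cohomology module H^{cd(𝔞,M)}_𝔞(M) is not finitely generated; consequently f_𝔞(M) ≤ cd(𝔞, M). -/
open TensorProduct CategoryTheory DirectSum

/-- The `n`-th local cohomology of `M` with support in `I`. -/
noncomputable def locCoh (R : Type) [CommRing R] (I : Ideal R) (n : ℕ)
    (M : Type) [AddCommGroup M] [Module R M] : ModuleCat R :=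
  (localCohomology I n).obj (ModuleCat.of R M)

/-- The cohomological dimension `cd(I, M)`: the supremum, in `{-∞} ∪ ℕ ∪ {+∞}`, of the degrees
in which the local cohomology of `M` with support in `I` is nonvanishing (`⊥ = -∞` if it
vanishes everywhere). -/
noncomputable def cohDim (R : Type) [CommRing R] (I : Ideal R)
    (M : Type) [AddCommGroup M] [Module R M] : WithBot ℕ∞ :=
  sSup {d : WithBot ℕ∞ | ∃ n : ℕ, d = (n : ℕ∞) ∧ Nontrivial (locCoh R I n M)}

/-- `grade(I, M)`: the infimum of the degrees in which the local cohomology of `M` with support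
in `I` is nonvanishing, `+∞` if it vanishes everywhere (e.g. when `IM = M`). -/
noncomputable def gradeDim (R : Type) [CommRing R] (I : Ideal R)
    (M : Type) [AddCommGroup M] [Module R M] : ℕ∞ :=
  sInf {d : ℕ∞ | ∃ n : ℕ, d = n ∧ Nontrivial (locCoh R I n M)}

/-- The finiteness dimension `f_I(M)`: the infimum of the degrees in which the local cohomology
of `M` with support in `I` is not a finitely generated module. -/
noncomputable def finDim (R : Type) [CommRing R] (I : Ideal R)
    (M : Type) [AddCommGroup M] [Module R M] : ℕ∞ :=
  sInf {d : ℕ∞ | ∃ n : ℕ, d = n ∧ ¬ Module.Finite R (locCoh R I n M)}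

namespace CategoryTheory

open Limits

lemma ShortComplex.exists_exact_of_iso {C : Type*} [Category* C] [HasZeroMorphisms C]
    {A₁ A₂ A₃ B₁ B₂ B₃ : C} (e₁ : A₁ ≅ B₁) (e₂ : A₂ ≅ B₂) (e₃ : A₃ ≅ B₃)
    {f : A₁ ⟶ A₂} {g : A₂ ⟶ A₃} {f' : B₁ ⟶ B₂} {g' : B₂ ⟶ B₃} {w : f' ≫ g' = 0}
    (h : (ShortComplex.mk f' g' w).Exact) (hf : f = e₁.hom ≫ f' ≫ e₂.inv)
    (hg : g = e₂.hom ≫ g' ≫ e₃.inv) : ∃ w, (ShortComplex.mk f g w).Exact := by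
  have hw : f ≫ g = 0 := by simp [hf, hg, reassoc_of% w]
  exact ⟨hw, ShortComplex.exact_of_iso (ShortComplex.isoMk e₁.symm e₂.symm e₃.symm
    (by simp [hf]) (by simp [hg])) h⟩

namespace Functor

section

variable {C D : Type*} [Category* C] [Category* D] [Abelian C]
  [Abelian D] {F G H : C ⥤ D} [F.Additive] [G.Additive] [H.Additive]

/-- Evaluating a complex of additive functors on a projective resolution. -/
noncomputable abbrev resolutionShortComplex (α : F ⟶ G) (β : G ⟶ H)
    (w : ∀ X, α.app X ≫ β.app X = 0) {X : C} (P : ProjectiveResolution X) :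
    ShortComplex (ChainComplex D ℕ) :=
  ShortComplex.mk ((NatTrans.mapHomologicalComplex α _).app P.complex)
    ((NatTrans.mapHomologicalComplex β _).app P.complex) (by ext n; exact w _)

/-- A chain map between projective resolutions induces a morphism between the evaluations of a
complex of additive functors. -/
noncomputable abbrev resolutionShortComplexMap (α : F ⟶ G) (β : G ⟶ H)
    (w : ∀ X, α.app X ≫ β.app X = 0) {X Y : C} {P : ProjectiveResolution X}
    {Q : ProjectiveResolution Y} (φ : P.complex ⟶ Q.complex) :
    resolutionShortComplex α β w P ⟶ resolutionShortComplex α β w Q where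
  τ₁ := (F.mapHomologicalComplex _).map φ
  τ₂ := (G.mapHomologicalComplex _).map φ
  τ₃ := (H.mapHomologicalComplex _).map φ
  comm₁₂ := (NatTrans.mapHomologicalComplex α _).naturality φ
  comm₂₃ := (NatTrans.mapHomologicalComplex β _).naturality φ

lemma resolutionShortComplex_shortExact (α : F ⟶ G) (β : G ⟶ H)
    (w : ∀ X, α.app X ≫ β.app X = 0)
    (hS : ∀ (P : C) [Projective P], (ShortComplex.mk _ _ (w P)).ShortExact)
    {X : C} (P : ProjectiveResolution X) :
    (resolutionShortComplex α β w P).ShortExact :=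
  HomologicalComplex.shortExact_of_degreewise_shortExact _ fun i ↦ hS (P.complex.X i)

end

variable {C D : Type*} [Category* C] [Category* D] [Abelian C] [HasProjectiveResolutions C]
  [Abelian D] {F G H : C ⥤ D} [F.Additive] [G.Additive] [H.Additive]

/-- The value of a left derived functor as the homology of a complex. -/
noncomputable def leftDerivedObjIso (F : C ⥤ D) [F.Additive] {X : C} (P : ProjectiveResolution X)
    (n : ℕ) : (F.leftDerived n).obj X ≅ ((F.mapHomologicalComplex _).obj P.complex).homology n :=
  P.isoLeftDerivedObj F n

lemma leftDerived_map_eq' (F : C ⥤ D) [F.Additive] (n : ℕ) {X Y : C} (f : X ⟶ Y)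
    {P : ProjectiveResolution X} {Q : ProjectiveResolution Y} (g : P.complex ⟶ Q.complex)
    (w : g ≫ Q.π = P.π ≫ (ChainComplex.single₀ C).map f) :
    (F.leftDerived n).map f = (F.leftDerivedObjIso P n).hom ≫
      HomologicalComplex.homologyMap ((F.mapHomologicalComplex _).map g) n ≫
        (F.leftDerivedObjIso Q n).inv :=
  F.leftDerived_map_eq n f g w

lemma leftDerived_app_eq' (α : F ⟶ G) {X : C} (P : ProjectiveResolution X) (n : ℕ) :
    (NatTrans.leftDerived α n).app X = (F.leftDerivedObjIso P n).hom ≫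
      HomologicalComplex.homologyMap ((NatTrans.mapHomologicalComplex α _).app P.complex) n ≫
        (G.leftDerivedObjIso P n).inv :=
  P.leftDerived_app_eq α n

theorem exists_leftDerived_connecting (α : F ⟶ G) (β : G ⟶ H)
    (w : ∀ X, α.app X ≫ β.app X = 0)
    (hS : ∀ (P : C) [Projective P], (ShortComplex.mk _ _ (w P)).ShortExact) (n : ℕ) :
    ∃ δ : H.leftDerived (n + 1) ⟶ F.leftDerived n,
      (∀ X, ∃ h, (ShortComplex.mk ((NatTrans.leftDerived β (n + 1)).app X) (δ.app X) h).Exact) ∧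
      (∀ X, ∃ h, (ShortComplex.mk (δ.app X) ((NatTrans.leftDerived α n).app X) h).Exact) := by
  have hE {X : C} (P : ProjectiveResolution X) := resolutionShortComplex_shortExact α β w hS P
  have hij : (ComplexShape.down ℕ).Rel (n + 1) n := rfl
  let δ : H.leftDerived (n + 1) ⟶ F.leftDerived n :=
    { app := fun X ↦ (H.leftDerivedObjIso (projectiveResolution X) (n + 1)).hom ≫
        (hE (projectiveResolution X)).δ (n + 1) n hij ≫
        (F.leftDerivedObjIso (projectiveResolution X) n).inv
      naturality := fun X Y f ↦ by
        have comm := ProjectiveResolution.lift_commutes f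
          (projectiveResolution X) (projectiveResolution Y)
        rw [leftDerived_map_eq' F n f _ comm, leftDerived_map_eq' H (n + 1) f _ comm]
        have nat := HomologicalComplex.HomologySequence.δ_naturality
          (resolutionShortComplexMap α β w
            (ProjectiveResolution.lift f (projectiveResolution X) (projectiveResolution Y)))
          (hE _) (hE _) (n + 1) n hij
        simp only [Category.assoc, Iso.inv_hom_id_assoc]
        rw [← reassoc_of% nat] }
  exact ⟨δ, fun X ↦ ShortComplex.exists_exact_of_iso _ _ _
      ((hE (projectiveResolution X)).homology_exact₃ (n + 1) n hij) (leftDerived_app_eq' _ _ _) rfl,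
    fun X ↦ ShortComplex.exists_exact_of_iso _ _ _
      ((hE (projectiveResolution X)).homology_exact₁ (n + 1) n hij) rfl (leftDerived_app_eq' _ _ _)⟩

theorem leftDerived_exact (α : F ⟶ G) (β : G ⟶ H)
    (w : ∀ X, α.app X ≫ β.app X = 0)
    (hS : ∀ (P : C) [Projective P], (ShortComplex.mk _ _ (w P)).ShortExact) (n : ℕ) (X : C) :
    ∃ h, (ShortComplex.mk ((NatTrans.leftDerived α n).app X)
      ((NatTrans.leftDerived β n).app X) h).Exact :=
  ShortComplex.exists_exact_of_iso _ _ _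
    ((resolutionShortComplex_shortExact α β w hS (projectiveResolution X)).homology_exact₂ n)
    (leftDerived_app_eq' _ _ _) (leftDerived_app_eq' _ _ _)

/-- The comparison `F.leftDerived 0 ⟶ F` is natural in `F`. -/
lemma fromLeftDerivedZero_naturality (α : F ⟶ G) (X : C) :
    (NatTrans.leftDerived α 0).app X ≫ G.fromLeftDerivedZero.app X =
      F.fromLeftDerivedZero.app X ≫ α.app X := by
  let P := projectiveResolution X
  have eq (F : C ⥤ D) [F.Additive] : F.fromLeftDerivedZero.app X =
      (F.leftDerivedObjIso P 0).hom ≫ HomologicalComplex.homologyι _ 0 ≫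
        P.fromLeftDerivedZero' F := P.fromLeftDerivedZero_eq F
  have h : HomologicalComplex.opcyclesMap
      ((NatTrans.mapHomologicalComplex α (ComplexShape.down ℕ)).app P.complex) 0 ≫
      P.fromLeftDerivedZero' G = P.fromLeftDerivedZero' F ≫ α.app X := by
    rw [← cancel_epi (HomologicalComplex.pOpcycles _ _),
      ProjectiveResolution.pOpcycles_comp_fromLeftDerivedZero'_assoc,
      HomologicalComplex.p_opcyclesMap_assoc,
      ProjectiveResolution.pOpcycles_comp_fromLeftDerivedZero']
    exact (α.naturality (P.π.f 0)).symm
  rw [leftDerived_app_eq' α P 0, eq F, eq G]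
  simp only [Category.assoc, Iso.inv_hom_id_assoc]
  rw [HomologicalComplex.homologyι_naturality_assoc, h]

end Functor

end CategoryTheory

section ExtModule

open Limits Opposite

universe u

variable {R : Type u} [CommRing R]

/-- The right exact functor to the opposite category whose left derived functors are
`Ext(-, Y)`. -/
noncomputable abbrev homRightOp (Y : ModuleCat.{u} R) : ModuleCat.{u} R ⥤ (ModuleCat.{u} R)ᵒᵖ :=
  ((linearYoneda R (ModuleCat.{u} R)).obj Y).rightOp

/-- Functoriality of `homRightOp`. -/
noncomputable abbrev homRightOpMap {Y Z : ModuleCat.{u} R} (f : Y ⟶ Z) :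
    homRightOp Z ⟶ homRightOp Y :=
  NatTrans.rightOp ((linearYoneda R (ModuleCat.{u} R)).map f)

lemma homRightOpMap_comp_app (S : ShortComplex (ModuleCat.{u} R)) (X : ModuleCat.{u} R) :
    (homRightOpMap S.g).app X ≫ (homRightOpMap S.f).app X = 0 := by
  apply Quiver.Hom.unop_inj
  ext (x : X ⟶ S.X₁)
  change (x ≫ S.f) ≫ S.g = 0
  simp

lemma homRightOp_shortExact {S : ShortComplex (ModuleCat.{u} R)} (hS : S.ShortExact)
    (P : ModuleCat.{u} R) [Projective P] :
    (ShortComplex.mk _ _ (homRightOpMap_comp_app S P)).ShortExact := by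
  have := hS.mono_f
  have := hS.epi_g
  have w := congrArg Quiver.Hom.unop (homRightOpMap_comp_app S P)
  have h : (ShortComplex.mk ((homRightOpMap S.f).app P).unop
      ((homRightOpMap S.g).app P).unop w).ShortExact := by
    refine ShortComplex.ShortExact.mk' ?_ ?_ ?_
    · rw [ShortComplex.moduleCat_exact_iff]
      intro (x : P ⟶ S.X₂) (hx : x ≫ S.g = 0)
      exact ⟨hS.exact.lift x hx, hS.exact.lift_f x hx⟩
    · rw [ModuleCat.mono_iff_injective]
      intro (x : P ⟶ S.X₁) (y : P ⟶ S.X₁) (h : x ≫ S.f = y ≫ S.f)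
      exact (cancel_mono S.f).1 h
    · rw [ModuleCat.epi_iff_surjective]
      intro (x : P ⟶ S.X₃)
      exact ⟨Projective.factorThru x S.g, Projective.factorThru_comp x S.g⟩
  exact h.op

theorem Ext.exists_connecting {S : ShortComplex (ModuleCat.{u} R)} (hS : S.ShortExact) (n : ℕ) :
    ∃ δ : (Ext R (ModuleCat.{u} R) n).flip.obj S.X₃ ⟶
        (Ext R (ModuleCat.{u} R) (n + 1)).flip.obj S.X₁,
      (∀ X z, δ.app X z = 0 → ∃ y, ((Ext R (ModuleCat.{u} R) n).obj X).map S.g y = z) ∧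
      (∀ X y, δ.app X (((Ext R (ModuleCat.{u} R) n).obj X).map S.g y) = 0) ∧
      (∀ X w, ((Ext R (ModuleCat.{u} R) (n + 1)).obj X).map S.f w = 0 → ∃ z, δ.app X z = w) := by
  obtain ⟨δ, h₁, h₂⟩ := Functor.exists_leftDerived_connecting (homRightOpMap S.g)
    (homRightOpMap S.f) (homRightOpMap_comp_app S) (fun P _ ↦ homRightOp_shortExact hS P) n
  refine ⟨{ app := fun X ↦ (δ.app X.unop).unop
            naturality := fun X Y g ↦ congrArg Quiver.Hom.unop (δ.naturality g.unop).symm },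
    fun X z hz ↦ ?_, fun X y ↦ ?_, fun X w hw ↦ ?_⟩
  · obtain ⟨_, h⟩ := h₂ X.unop
    exact (ShortComplex.moduleCat_exact_iff _).1 h.unop z hz
  · obtain ⟨w, -⟩ := h₂ X.unop
    exact ConcreteCategory.congr_hom (congrArg Quiver.Hom.unop w) y
  · obtain ⟨_, h⟩ := h₁ X.unop
    exact (ShortComplex.moduleCat_exact_iff _).1 h.unop w hw

theorem Ext.exact_covariant {S : ShortComplex (ModuleCat.{u} R)} (hS : S.ShortExact) (n : ℕ)
    (X : (ModuleCat.{u} R)ᵒᵖ) (y : ((Ext R (ModuleCat.{u} R) n).obj X).obj S.X₂)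
    (hy : ((Ext R (ModuleCat.{u} R) n).obj X).map S.g y = 0) :
    ∃ x, ((Ext R (ModuleCat.{u} R) n).obj X).map S.f x = y := by
  obtain ⟨_, h⟩ := Functor.leftDerived_exact (homRightOpMap S.g)
    (homRightOpMap S.f) (homRightOpMap_comp_app S) (fun P _ ↦ homRightOp_shortExact hS P) n X.unop
  exact (ShortComplex.moduleCat_exact_iff _).1 h.unop y hy

lemma Ext.isZero_of_injective (X T : ModuleCat.{u} R) [Injective T] (n : ℕ) :
    IsZero (((Ext R (ModuleCat.{u} R) (n + 1)).obj (op X)).obj T) := by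
  let P := projectiveResolution X
  refine IsZero.of_iso ?_ (P.isoExt (n + 1) T)
  rw [← HomologicalComplex.exactAt_iff_isZero_homology,
    HomologicalComplex.exactAt_iff' _ n (n + 1) (n + 2) (by simp) (by simp),
    ShortComplex.moduleCat_exact_iff]
  intro (x : P.complex.X (n + 1) ⟶ T) (hx : P.complex.d (n + 2) (n + 1) ≫ x = 0)
  exact ⟨(P.exact_succ n).descToInjective x hx, (P.exact_succ n).comp_descToInjective x hx⟩

/-- Multiplication by a scalar on the second variable kills `Ext` when it kills the first
variable. -/
lemma Ext.map_smul_eq_zero (X Y : ModuleCat.{u} R) (r : R) (hr : r • 𝟙 X = 0) (n : ℕ) :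
    ((Ext R (ModuleCat.{u} R) n).obj (op X)).map (r • 𝟙 Y) = 0 := by
  let P := projectiveResolution X
  let F := homRightOp Y
  have e₁ := Functor.leftDerived_app_eq' (homRightOpMap (r • 𝟙 Y)) P n
  have e₂ := F.leftDerived_map_eq' n (P := P) (Q := P) (r • 𝟙 X) (r • 𝟙 P.complex) (by
    ext : 1
    simp
    exact ((Linear.comp_smul (Y := X) _ _ _ _ _).trans
      (congrArg (r • ·) (Category.comp_id (Y := X) _))).symm)
  have e₃ := F.leftDerived_map_eq' n (P := P) (Q := P) (r • 𝟙 X) 0 (by simp [hr])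
  have e₄ : (NatTrans.mapHomologicalComplex (homRightOpMap (r • 𝟙 Y)) _).app P.complex =
      (F.mapHomologicalComplex (ComplexShape.down ℕ)).map (r • 𝟙 P.complex) := by
    ext i
    apply Quiver.Hom.unop_inj
    ext (x : P.complex.X i ⟶ Y)
    change x ≫ (r • 𝟙 Y) = (r • 𝟙 P.complex.X i) ≫ x
    simp
  have : (NatTrans.leftDerived (homRightOpMap (r • 𝟙 Y)) n).app X = 0 := by
    rw [e₁, e₄]
    refine e₂.symm.trans (e₃.trans ?_)
    simp
  exact congrArg Quiver.Hom.unop this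

instance (Y : ModuleCat.{u} R) : PreservesFiniteColimits (homRightOp Y) := by
  have : PreservesLimits ((linearYoneda R (ModuleCat.{u} R)).obj Y ⋙ forget _) :=
    inferInstanceAs (PreservesLimits (yoneda.obj Y))
  have : PreservesLimits ((linearYoneda R (ModuleCat.{u} R)).obj Y) :=
    preservesLimits_of_reflects_of_preserves _ (forget _)
  exact preservesFiniteColimits_rightOp _

/-- The canonical identification of `Hom` with `Ext⁰`. -/
noncomputable def homToExtZero (X : (ModuleCat.{u} R)ᵒᵖ) (Y : ModuleCat.{u} R) (φ : X.unop ⟶ Y) :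
    ((Ext R (ModuleCat.{u} R) 0).obj X).obj Y :=
  ((homRightOp Y).fromLeftDerivedZero.app X.unop).unop φ

lemma homToExtZero_surjective (X : (ModuleCat.{u} R)ᵒᵖ) (Y : ModuleCat.{u} R) :
    Function.Surjective (homToExtZero X Y) := by
  have : IsIso ((homRightOp Y).fromLeftDerivedZero.app X.unop).unop := inferInstance
  exact (ConcreteCategory.bijective_of_isIso
    ((homRightOp Y).fromLeftDerivedZero.app X.unop).unop).2

lemma homToExtZero_precomp {X X' : (ModuleCat.{u} R)ᵒᵖ} (f : X ⟶ X') (Y : ModuleCat.{u} R)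
    (φ : X.unop ⟶ Y) : ((Ext R (ModuleCat.{u} R) 0).map f).app Y (homToExtZero X Y φ) =
      homToExtZero X' Y (f.unop ≫ φ) :=
  (ConcreteCategory.congr_hom
    (congrArg Quiver.Hom.unop ((homRightOp Y).fromLeftDerivedZero.naturality f.unop)) φ)

lemma homToExtZero_postcomp (X : (ModuleCat.{u} R)ᵒᵖ) {Y Z : ModuleCat.{u} R} (g : Y ⟶ Z)
    (φ : X.unop ⟶ Y) : ((Ext R (ModuleCat.{u} R) 0).obj X).map g (homToExtZero X Y φ) =
      homToExtZero X Z (φ ≫ g) :=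
  (ConcreteCategory.congr_hom (congrArg Quiver.Hom.unop
    (Functor.fromLeftDerivedZero_naturality (homRightOpMap g) X.unop)) φ)

end ExtModule

namespace localCohomology

open Limits Opposite

universe u

variable {R : Type u} [CommRing R] (𝔞 : Ideal R)

/-- The projection `R ⧸ 𝔞 ^ l ⟶ R ⧸ 𝔞 ^ k` for `k ≤ l`. -/
noncomputable def powProj {k l : ℕ} (h : k ≤ l) :
    ModuleCat.of R (R ⧸ 𝔞 ^ l) ⟶ ModuleCat.of R (R ⧸ 𝔞 ^ k) :=
  (ringModIdeals (idealPowersDiagram 𝔞)).map (homOfLE h).op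

/-- The structure map from `Extⁱ(R ⧸ 𝔞 ^ k, -)` to local cohomology. -/
noncomputable def fromExt (i k : ℕ) :
    (Ext R (ModuleCat.{u} R) i).obj (op (ModuleCat.of R (R ⧸ 𝔞 ^ k))) ⟶ localCohomology 𝔞 i :=
  colimit.ι (diagram (idealPowersDiagram 𝔞) i) (op (op k))

lemma powProj_comp_fromExt (i : ℕ) {k l : ℕ} (h : k ≤ l) :
    (Ext R (ModuleCat.{u} R) i).map (powProj 𝔞 h).op ≫ fromExt 𝔞 i l = fromExt 𝔞 i k :=
  colimit.w (diagram (idealPowersDiagram 𝔞) i) (homOfLE h).op.op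

variable {𝔞} {i : ℕ} {M : ModuleCat.{u} R}

lemma fromExt_powProj {k l : ℕ} (h : k ≤ l)
    (y : ((Ext R (ModuleCat.{u} R) i).obj (op (ModuleCat.of R (R ⧸ 𝔞 ^ k)))).obj M) :
    (fromExt 𝔞 i l).app M (((Ext R (ModuleCat.{u} R) i).map (powProj 𝔞 h).op).app M y) =
      (fromExt 𝔞 i k).app M y :=
  ConcreteCategory.congr_hom (NatTrans.congr_app (powProj_comp_fromExt 𝔞 i h) M) y

instance : PreservesColimitsOfShape (ℕᵒᵖ)ᵒᵖ (forget (ModuleCat.{u} R)) :=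
  have := preservesSmallestFilteredColimits_of_preservesFilteredColimits (forget (ModuleCat.{u} R))
  inferInstance

lemma exists_fromExt (x : (localCohomology 𝔞 i).obj M) :
    ∃ k y, (fromExt 𝔞 i k).app M y = x := by
  obtain ⟨j, y, h⟩ := Concrete.isColimit_exists_rep _ (isColimitOfPreserves
    ((evaluation _ _).obj M) (colimit.isColimit (diagram (idealPowersDiagram 𝔞) i))) x
  exact ⟨_, y, h⟩

lemma exists_powProj_eq_zero {k : ℕ}
    (y : ((Ext R (ModuleCat.{u} R) i).obj (op (ModuleCat.of R (R ⧸ 𝔞 ^ k)))).obj M)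
    (hy : (fromExt 𝔞 i k).app M y = 0) : ∃ l, ∃ h : k ≤ l,
      ((Ext R (ModuleCat.{u} R) i).map (powProj 𝔞 h).op).app M y = 0 := by
  obtain ⟨j, f, g, h⟩ := (Concrete.isColimit_rep_eq_iff_exists _ (isColimitOfPreserves
    ((evaluation _ _).obj M) (colimit.isColimit (diagram (idealPowersDiagram 𝔞) i)))
    (i := op (op k)) (j := op (op k)) y 0).1 (hy.trans (map_zero _).symm)
  exact ⟨j.unop.unop, leOfHom f.unop.unop, h.trans (map_zero _)⟩

lemma map_fromExt {N : ModuleCat.{u} R} (f : M ⟶ N) {k : ℕ}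
    (y : ((Ext R (ModuleCat.{u} R) i).obj (op (ModuleCat.of R (R ⧸ 𝔞 ^ k)))).obj M) :
    (localCohomology 𝔞 i).map f ((fromExt 𝔞 i k).app M y) =
      (fromExt 𝔞 i k).app N (((Ext R (ModuleCat.{u} R) i).obj _).map f y) :=
  ConcreteCategory.congr_hom ((fromExt 𝔞 i k).naturality f).symm y

lemma powProj_map {N : ModuleCat.{u} R} (f : M ⟶ N) {k l : ℕ} (h : k ≤ l)
    (y : ((Ext R (ModuleCat.{u} R) i).obj (op (ModuleCat.of R (R ⧸ 𝔞 ^ k)))).obj M) :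
    ((Ext R (ModuleCat.{u} R) i).map (powProj 𝔞 h).op).app N
      (((Ext R (ModuleCat.{u} R) i).obj _).map f y) = ((Ext R (ModuleCat.{u} R) i).obj _).map f
        (((Ext R (ModuleCat.{u} R) i).map (powProj 𝔞 h).op).app M y) :=
  ConcreteCategory.congr_hom
    (((Ext R (ModuleCat.{u} R) i).map (powProj 𝔞 h).op).naturality f) y

theorem exists_map_eq_of_map_eq_zero {S : ShortComplex (ModuleCat.{u} R)} (hS : S.ShortExact)
    (y : (localCohomology 𝔞 i).obj S.X₂) (hy : (localCohomology 𝔞 i).map S.g y = 0) :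
    ∃ x, (localCohomology 𝔞 i).map S.f x = y := by
  obtain ⟨k, y, rfl⟩ := exists_fromExt y
  rw [map_fromExt] at hy
  obtain ⟨l, h, hl⟩ := exists_powProj_eq_zero _ hy
  rw [powProj_map] at hl
  obtain ⟨x, hx⟩ := Ext.exact_covariant hS _ _ _ hl
  exact ⟨(fromExt 𝔞 i l).app _ x, by rw [map_fromExt, hx, fromExt_powProj]⟩

theorem map_surjective_of_subsingleton {S : ShortComplex (ModuleCat.{u} R)} (hS : S.ShortExact)
    (h₁ : Subsingleton ((localCohomology 𝔞 (i + 1)).obj S.X₁)) :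
    Function.Surjective ((localCohomology 𝔞 i).map S.g) := by
  intro z
  obtain ⟨k, z, rfl⟩ := exists_fromExt z
  obtain ⟨δ, h, -, -⟩ := Ext.exists_connecting hS i
  obtain ⟨l, hl, hz⟩ := exists_powProj_eq_zero (𝔞 := 𝔞) (δ.app _ z) (Subsingleton.elim _ _)
  have hδ := ConcreteCategory.congr_hom (δ.naturality (powProj 𝔞 hl).op) z
  obtain ⟨y, hy⟩ := h _ _ (hδ.trans hz)
  refine ⟨(fromExt 𝔞 i l).app _ y, ?_⟩
  rw [map_fromExt, hy]
  exact fromExt_powProj hl z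

theorem subsingleton_of_map_surjective {S : ShortComplex (ModuleCat.{u} R)} (hS : S.ShortExact)
    (hg : Function.Surjective ((localCohomology 𝔞 i).map S.g))
    (h₂ : Subsingleton ((localCohomology 𝔞 (i + 1)).obj S.X₂)) :
    Subsingleton ((localCohomology 𝔞 (i + 1)).obj S.X₁) := by
  refine subsingleton_of_forall_eq 0 fun w ↦ ?_
  obtain ⟨k, w, rfl⟩ := exists_fromExt w
  obtain ⟨δ, -, h, h'⟩ := Ext.exists_connecting hS i
  obtain ⟨l, hl, hw⟩ := exists_powProj_eq_zero (𝔞 := 𝔞)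
    (((Ext R (ModuleCat.{u} R) (i + 1)).obj _).map S.f w) (Subsingleton.elim _ _)
  rw [powProj_map] at hw
  obtain ⟨z, hz⟩ := h' _ _ hw
  obtain ⟨y, hy⟩ := hg ((fromExt 𝔞 i l).app _ z)
  obtain ⟨m, y, rfl⟩ := exists_fromExt y
  obtain ⟨p, hlp, hmp⟩ : ∃ p, l ≤ p ∧ m ≤ p := ⟨max l m, by simp, by simp⟩
  rw [← fromExt_powProj hlp z, ← fromExt_powProj hmp y, map_fromExt, ← sub_eq_zero,
    ← map_sub] at hy
  obtain ⟨q, hpq, hq⟩ := exists_powProj_eq_zero _ hy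
  rw [map_sub, sub_eq_zero, powProj_map] at hq
  have hδ {a b : ℕ} (hab : a ≤ b) (t) := ConcreteCategory.congr_hom
    (δ.naturality (powProj 𝔞 hab).op) t
  have h₃ := h _ (((Ext R (ModuleCat.{u} R) i).map (powProj 𝔞 hpq).op).app S.X₂
    (((Ext R (ModuleCat.{u} R) i).map (powProj 𝔞 hmp).op).app S.X₂ y))
  rw [hq] at h₃
  rw [← fromExt_powProj hl, ← hz, ← fromExt_powProj hlp, ← fromExt_powProj hpq]
  exact (congrArg _ ((congrArg _ (hδ hlp z).symm).trans ((hδ hpq _).symm.trans h₃))).trans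
    (map_zero _)

end localCohomology

section PowTorsion

universe u

variable {R : Type u} [CommRing R] (𝔞 : Ideal R)

/-- A module is `𝔞`-power torsion if each of its elements is killed by a power of `𝔞`. -/
def IsPowTorsion (M : Type*) [AddCommGroup M] [Module R M] : Prop :=
  ∀ x : M, ∃ k, ∀ a ∈ 𝔞 ^ k, a • x = 0

/-- The submodule of elements killed by a power of `𝔞`. -/
def powTorsion (M : Type*) [AddCommGroup M] [Module R M] : Submodule R M where
  carrier := {x | ∃ k, ∀ a ∈ 𝔞 ^ k, a • x = 0}
  zero_mem' := ⟨0, by simp⟩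
  add_mem' := by
    rintro x y ⟨k, hk⟩ ⟨l, hl⟩
    refine ⟨max k l, fun a ha ↦ ?_⟩
    rw [smul_add, hk a (Ideal.pow_le_pow_right (by simp) ha),
      hl a (Ideal.pow_le_pow_right (by simp) ha), add_zero]
  smul_mem' := by
    rintro r x ⟨k, hk⟩
    exact ⟨k, fun a ha ↦ by rw [smul_comm, hk a ha, smul_zero]⟩

variable {M N : Type*} [AddCommGroup M] [Module R M] [AddCommGroup N] [Module R N]

variable (M) in
lemma isPowTorsion_powTorsion : IsPowTorsion 𝔞 (powTorsion 𝔞 M) := fun ⟨_, k, h⟩ ↦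
  ⟨k, fun a ha ↦ Subtype.ext (h a ha)⟩

variable {𝔞}

lemma IsPowTorsion.of_surjective (h : IsPowTorsion 𝔞 M) (f : M →ₗ[R] N)
    (hf : Function.Surjective f) : IsPowTorsion 𝔞 N := by
  intro y
  obtain ⟨x, rfl⟩ := hf y
  obtain ⟨k, hk⟩ := h x
  exact ⟨k, fun a ha ↦ by rw [← map_smul, hk a ha, map_zero]⟩

lemma IsPowTorsion.exists_pow_smul_eq_zero (h : IsPowTorsion 𝔞 M) {P : Type*} [AddCommGroup P]
    [Module R P] [Module.Finite R P] (f : P →ₗ[R] M) :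
    ∃ k, ∀ a ∈ 𝔞 ^ k, ∀ x, a • f x = 0 := by
  obtain ⟨s, hs⟩ := Module.Finite.fg_top (R := R) (M := P)
  choose k hk using fun x ↦ h (f x)
  refine ⟨s.sup k, fun a ha x ↦ ?_⟩
  have hx : x ∈ LinearMap.ker (a • f) := by
    have : (⊤ : Submodule R P) ≤ LinearMap.ker (a • f) := by
      rw [← hs, Submodule.span_le]
      exact fun y hy ↦ hk y a (Ideal.pow_le_pow_right (Finset.le_sup hy) ha)
    exact this trivial
  exact hx

theorem injective_powTorsion [IsNoetherianRing R] (E : Type u) [AddCommGroup E] [Module R E]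
    [Module.Injective R E] : Module.Injective R (powTorsion 𝔞 E) := by
  refine Module.Baer.injective fun I g ↦ ?_
  obtain ⟨n, hn⟩ := (isPowTorsion_powTorsion 𝔞 E).exists_pow_smul_eq_zero g
  obtain ⟨k, hk⟩ := Ideal.exists_pow_inf_eq_pow_smul 𝔞 (I : Submodule R R)
  have hg (x : I) (hx : (x : R) ∈ 𝔞 ^ (n + k)) : g x = 0 := by
    have h₁ : (x : R) ∈ 𝔞 ^ n • I := by
      have : (x : R) ∈ 𝔞 ^ (n + k) • (⊤ : Submodule R R) ⊓ I := ⟨by simpa using hx, x.2⟩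
      rw [hk _ (by simp), Nat.add_sub_cancel] at this
      exact Submodule.smul_mono le_rfl inf_le_right this
    have h₂ : 𝔞 ^ n • I ≤ (LinearMap.ker g).map (Submodule.subtype I) := by
      refine Submodule.smul_le.2 fun a ha y hy ↦ ⟨a • ⟨y, hy⟩, ?_, rfl⟩
      exact (map_smul g a ⟨y, hy⟩).trans (hn a ha _)
    obtain ⟨y, hy, hyx⟩ := h₂ h₁
    rwa [show y = x from Subtype.ext hyx] at hy
  let J : Submodule R I := Submodule.comap (Submodule.subtype I) (𝔞 ^ (n + k))
  obtain ⟨h, hh⟩ := Module.Injective.out (Submodule.mapQ J (𝔞 ^ (n + k)) (Submodule.subtype I) le_rfl)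
    (by
      rw [← LinearMap.ker_eq_bot, Submodule.ker_mapQ]
      simp [J]) ((powTorsion 𝔞 E).subtype ∘ₗ J.liftQ g fun x hx ↦ hg x hx)
  refine ⟨(h ∘ₗ (𝔞 ^ (n + k) : Submodule R R).mkQ).codRestrict _ fun r ↦ ⟨n + k, fun a ha ↦ ?_⟩,
    fun x hx ↦ Subtype.ext (hh (J.mkQ ⟨x, hx⟩))⟩
  rw [← map_smul, LinearMap.comp_apply, Submodule.mkQ_apply, smul_eq_mul,
    (Submodule.Quotient.mk_eq_zero _).2 (Ideal.mul_mem_right _ _ ha), map_zero]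

theorem IsPowTorsion.exists_injective [IsNoetherianRing R] {N : Type u} [AddCommGroup N]
    [Module R N] (hN : IsPowTorsion 𝔞 N) :
    ∃ (T : ModuleCat.{u} R) (f : N →ₗ[R] T), Function.Injective f ∧ IsPowTorsion 𝔞 T ∧
      Injective T := by
  let E := Injective.under (ModuleCat.of R N)
  have : Injective (ModuleCat.of R E) := inferInstanceAs (Injective E)
  have : Module.Injective R E := Module.injective_module_of_injective_object R E
  have := injective_powTorsion (𝔞 := 𝔞) E
  let f : N →ₗ[R] E := (Injective.ι (ModuleCat.of R N)).hom
  have hf : Function.Injective f := (ModuleCat.mono_iff_injective _).1 inferInstance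
  refine ⟨ModuleCat.of R (powTorsion 𝔞 E), f.codRestrict _ fun x ↦ ?_, fun x y h ↦ ?_,
    isPowTorsion_powTorsion 𝔞 E, Module.injective_object_of_injective_module R _⟩
  · obtain ⟨k, hk⟩ := hN x
    exact ⟨k, fun a ha ↦ by rw [← map_smul, hk a ha, map_zero]⟩
  · exact hf (congrArg Subtype.val h)

lemma quotient_powTorsion_eq_zero [IsNoetherianRing R] {Q : Type*}
    [AddCommGroup Q] [Module R Q] [Module.Finite R Q] (q : Q ⧸ powTorsion 𝔞 Q)
    (hq : ∀ a ∈ 𝔞, a • q = 0) : q = 0 := by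
  obtain ⟨q, rfl⟩ := Submodule.mkQ_surjective _ q
  obtain ⟨k, hk⟩ := (isPowTorsion_powTorsion 𝔞 Q).exists_pow_smul_eq_zero LinearMap.id
  refine (Submodule.Quotient.mk_eq_zero _).2 ⟨k + 1, fun a ha ↦ ?_⟩
  rw [pow_succ] at ha
  induction ha using Submodule.mul_induction_on' with
  | mem_mul_mem a ha b hb =>
    have h : b • q ∈ powTorsion 𝔞 Q := (Submodule.Quotient.mk_eq_zero _).1 (hq b hb)
    rw [mul_smul]
    exact congrArg Subtype.val (hk a ha ⟨_, h⟩)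
  | add a _ b _ ha hb => rw [add_smul, ha, hb, add_zero]

lemma exists_mem_regular [IsNoetherianRing R] {Q : Type*} [AddCommGroup Q]
    [Module R Q] [Module.Finite R Q] (hQ : ∀ q : Q, (∀ a ∈ 𝔞, a • q = 0) → q = 0) :
    ∃ x ∈ 𝔞, ∀ q : Q, x • q = 0 → q = 0 := by
  by_contra! h
  have hsub : (𝔞 : Set R) ⊆ ⋃ p ∈ ((associatedPrimes.finite R Q).toFinset : Set (Ideal R)),
      (p : Set R) := by
    rw [Set.Finite.coe_toFinset, biUnion_associatedPrimes_eq_zero_divisors]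
    intro x hx
    obtain ⟨q, hq, h0⟩ := h x hx
    exact ⟨q, h0, hq⟩
  obtain ⟨p, hp, hle⟩ := (Ideal.subset_union_prime (f := id) ⊤ ⊤ fun p hp _ _ ↦
    ((Set.Finite.mem_toFinset _).1 hp).1).1 hsub
  obtain ⟨hp, q, rfl⟩ := isAssociatedPrime_iff.1 ((Set.Finite.mem_toFinset _).1 hp)
  refine hp.ne_top ((Ideal.eq_top_iff_one _).2 ?_)
  simpa [Submodule.mem_colon_singleton] using
    hQ q fun a ha ↦ by simpa [Submodule.mem_colon_singleton] using hle ha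

end PowTorsion

namespace localCohomology

open Limits Opposite

universe u

variable {R : Type u} [CommRing R] {𝔞 : Ideal R} {i : ℕ}

theorem subsingleton_of_injective (T : ModuleCat.{u} R) [Injective T] :
    Subsingleton ((localCohomology 𝔞 (i + 1)).obj T) := by
  refine subsingleton_of_forall_eq 0 fun w ↦ ?_
  obtain ⟨k, w, rfl⟩ := exists_fromExt w
  have := ModuleCat.subsingleton_of_isZero
    (Ext.isZero_of_injective (ModuleCat.of R (R ⧸ 𝔞 ^ k)) T i)
  rw [Subsingleton.elim w 0, map_zero]

theorem map_zero_surjective {M N : ModuleCat.{u} R} (hM : IsPowTorsion 𝔞 M) (g : M ⟶ N)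
    (hg : Function.Surjective g) : Function.Surjective ((localCohomology 𝔞 0).map g) := by
  intro z
  obtain ⟨k, z, rfl⟩ := exists_fromExt z
  obtain ⟨φ, rfl⟩ := homToExtZero_surjective _ _ z
  obtain ⟨b, hb⟩ := hg (φ (Ideal.Quotient.mk (𝔞 ^ k) 1))
  obtain ⟨m, hm⟩ := hM b
  let ψ : ModuleCat.of R (R ⧸ 𝔞 ^ (max k m)) ⟶ M := ModuleCat.ofHom
    (Submodule.liftQ (𝔞 ^ (max k m)) (LinearMap.toSpanSingleton R M b) fun a ha ↦
      hm a (Ideal.pow_le_pow_right (by simp) ha))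
  have hψ : ψ ≫ g = powProj 𝔞 (le_max_left k m) ≫ φ := by
    ext : 1
    refine Submodule.linearMap_qext _ (LinearMap.ext_ring ?_)
    change g ((1 : R) • b) = φ (Ideal.Quotient.mk (𝔞 ^ k) 1)
    rw [one_smul, hb]
  refine ⟨(fromExt 𝔞 0 (max k m)).app M (homToExtZero _ _ ψ), ?_⟩
  rw [map_fromExt, ← fromExt_powProj (le_max_left k m), homToExtZero_postcomp,
    homToExtZero_precomp]
  exact congrArg (fun t ↦ (fromExt 𝔞 0 (max k m)).app N (homToExtZero _ _ t)) hψ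

lemma shortExact_mkQ {R : Type*} [Ring R] {A B : Type u} [AddCommGroup A] [AddCommGroup B]
    [Module R A] [Module R B] (f : A →ₗ[R] B) (hf : Function.Injective f) :
    (ModuleCat.shortComplexOfCompEqZero f (LinearMap.range f).mkQ
      (LinearMap.range_mkQ_comp f)).ShortExact :=
  ModuleCat.shortComplex_shortExact _ (LinearMap.exact_map_mkQ_range f) hf
    (Submodule.mkQ_surjective _)

theorem subsingleton_of_isPowTorsion [IsNoetherianRing R] (i : ℕ) (N : Type u) [AddCommGroup N]
    [Module R N] (hN : IsPowTorsion 𝔞 N) :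
    Subsingleton ((localCohomology 𝔞 (i + 1)).obj (ModuleCat.of R N)) := by
  induction i generalizing N with
  | zero =>
    obtain ⟨T, f, hf, hT, _⟩ := hN.exists_injective
    exact subsingleton_of_map_surjective (shortExact_mkQ f hf)
      (map_zero_surjective hT _ (Submodule.mkQ_surjective _)) (subsingleton_of_injective T)
  | succ i ih =>
    obtain ⟨T, f, hf, hT, _⟩ := hN.exists_injective
    have := ih _ (hT.of_surjective _ (Submodule.mkQ_surjective (LinearMap.range f)))
    exact subsingleton_of_map_surjective (shortExact_mkQ f hf)
      (fun z ↦ ⟨0, Subsingleton.elim (α := (localCohomology 𝔞 (i + 1)).obj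
        (ModuleCat.of R (T ⧸ LinearMap.range f))) _ z⟩) (subsingleton_of_injective T)

theorem exists_map_smul_eq_zero (M : ModuleCat.{u} R)
    [Module.Finite R ((localCohomology 𝔞 i).obj M)] :
    ∃ k, ∀ r ∈ 𝔞 ^ k, (localCohomology 𝔞 i).map (r • 𝟙 M) = 0 := by
  obtain ⟨s, hs⟩ := Module.Finite.fg_top (R := R) (M := (localCohomology 𝔞 i).obj M)
  choose k y hk using fun x : (localCohomology 𝔞 i).obj M ↦ exists_fromExt x
  refine ⟨s.sup k, fun r hr ↦ ?_⟩
  have hX : r • 𝟙 (ModuleCat.of R (R ⧸ 𝔞 ^ s.sup k)) = 0 := by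
    ext : 1
    refine Submodule.linearMap_qext _ (LinearMap.ext_ring ?_)
    exact (Submodule.Quotient.mk_eq_zero _).2 (Ideal.mul_mem_right _ _ hr)
  have := Ext.map_smul_eq_zero _ M r hX i
  ext : 1
  refine LinearMap.ker_eq_top.1 (eq_top_iff.2 ?_)
  rw [← hs, Submodule.span_le]
  intro x hx
  change (localCohomology 𝔞 i).map (r • 𝟙 M) x = 0
  rw [← hk x, ← fromExt_powProj (Finset.le_sup hx), map_fromExt, this]
  exact map_zero _

end localCohomology

namespace localCohomology

open Limits Opposite

universe u

variable {R : Type u} [CommRing R] {𝔞 : Ideal R} {i : ℕ}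

lemma map_injective_of_map_eq_zero {S : ShortComplex (ModuleCat.{u} R)} (hS : S.ShortExact)
    (h : (localCohomology 𝔞 i).map S.f = 0) :
    Function.Injective ((localCohomology 𝔞 i).map S.g) := by
  refine (injective_iff_map_eq_zero _).2 fun y hy ↦ ?_
  obtain ⟨x, rfl⟩ := exists_map_eq_of_map_eq_zero hS y hy
  rw [h]
  rfl

/-- A finitely generated local cohomology module in positive degree, above which local cohomology
vanishes, is zero. -/
theorem subsingleton_of_finite [IsNoetherianRing R] (c : ℕ) {M : Type u} [AddCommGroup M]
    [Module R M] [Module.Finite R M] (N : Submodule R M) : ∀ (Q : Type u) [AddCommGroup Q]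
    [Module R Q] (g : M →ₗ[R] Q), Function.Surjective g → LinearMap.ker g = N →
    Module.Finite R ((localCohomology 𝔞 (c + 1)).obj (ModuleCat.of R Q)) →
    (∀ i > c, Subsingleton ((localCohomology 𝔞 (i + 1)).obj (ModuleCat.of R Q))) →
    Subsingleton ((localCohomology 𝔞 (c + 1)).obj (ModuleCat.of R Q)) := by
  induction N using WellFoundedGT.induction with
  | ind N ih =>
  intro Q _ _ g hg hN hfin hvan
  have : Module.Finite R Q := Module.Finite.of_surjective g hg
  let T := powTorsion 𝔞 Q
  have hS : (ModuleCat.shortComplexOfCompEqZero T.subtype T.mkQ (by ext; simp)).ShortExact :=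
    ModuleCat.shortComplex_shortExact _ (LinearMap.exact_subtype_mkQ T) T.injective_subtype
      T.mkQ_surjective
  have hT (i : ℕ) : Subsingleton ((localCohomology 𝔞 (i + 1)).obj (ModuleCat.of R T)) :=
    subsingleton_of_isPowTorsion i T (isPowTorsion_powTorsion 𝔞 Q)
  have hsurj (i : ℕ) := map_surjective_of_subsingleton hS (hT (i + 1))
  have hinj := map_injective_of_map_eq_zero (i := c + 1) hS (by
    ext x
    rw [Subsingleton.elim (α := (localCohomology 𝔞 (c + 1)).obj (ModuleCat.of R T)) x 0]
    simp)
  have : Module.Finite R ((localCohomology 𝔞 (c + 1)).obj (ModuleCat.of R (Q ⧸ T))) :=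
    Module.Finite.of_surjective _ (hsurj c)
  have hvan₁ (i : ℕ) (hi : i > c) :
      Subsingleton ((localCohomology 𝔞 (i + 1)).obj (ModuleCat.of R (Q ⧸ T))) :=
    have := hvan i hi
    (hsurj i).subsingleton
  suffices Subsingleton ((localCohomology 𝔞 (c + 1)).obj (ModuleCat.of R (Q ⧸ T))) from
    hinj.subsingleton
  rcases subsingleton_or_nontrivial (Q ⧸ T) with h | h
  · exact subsingleton_of_isPowTorsion c _ fun x ↦ ⟨0, fun _ _ ↦ Subsingleton.elim _ _⟩
  obtain ⟨x, hx, hreg⟩ := exists_mem_regular (𝔞 := 𝔞) (Q := Q ⧸ T)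
    quotient_powTorsion_eq_zero
  obtain ⟨k, hk⟩ := exists_map_smul_eq_zero (𝔞 := 𝔞) (i := c + 1) (ModuleCat.of R (Q ⧸ T))
  have hpow (k : ℕ) (q : Q ⧸ T) (hq : x ^ k • q = 0) : q = 0 := by
    induction k with
    | zero => simpa using hq
    | succ k ih => exact ih (hreg _ (by rwa [← mul_smul, ← pow_succ']))
  let f : (Q ⧸ T) →ₗ[R] Q ⧸ T := x ^ k • LinearMap.id
  have hf : Function.Injective f := (injective_iff_map_eq_zero _).2 fun q hq ↦ hpow k q hq
  have hS' := shortExact_mkQ f hf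
  have hinj' := map_injective_of_map_eq_zero (i := c + 1) hS' (hk _ (Ideal.pow_mem_pow hx k))
  have hsurj' (i : ℕ) (hi : i ≥ c) := map_surjective_of_subsingleton hS'
    (hvan₁ (i + 1) (by lia))
  suffices Subsingleton ((localCohomology 𝔞 (c + 1)).obj
    (ModuleCat.of R ((Q ⧸ T) ⧸ LinearMap.range f))) from hinj'.subsingleton
  refine ih (LinearMap.ker ((LinearMap.range f).mkQ ∘ₗ T.mkQ ∘ₗ g)) ?_ _ _ ?_ rfl
    (Module.Finite.of_surjective _ (hsurj' c le_rfl)) fun i hi ↦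
      have := hvan₁ i hi
      (hsurj' i hi.le).subsingleton
  · obtain ⟨q, hq⟩ := exists_ne (0 : Q ⧸ T)
    obtain ⟨m, hm⟩ := (T.mkQ_surjective.comp hg) (f q)
    refine lt_of_le_of_ne (fun m hm ↦ ?_) fun h ↦ ?_
    · rw [← hN] at hm
      simp [LinearMap.mem_ker.1 hm]
    · have hmN : m ∈ N := by
        rw [h, LinearMap.mem_ker]
        exact (Submodule.Quotient.mk_eq_zero _).2 ⟨q, hm.symm⟩
      rw [← hN, LinearMap.mem_ker] at hmN
      refine hq (hf ?_)
      rw [← hm, map_zero, Function.comp_apply, hmN, map_zero]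
  · exact (Submodule.mkQ_surjective _).comp (T.mkQ_surjective.comp hg)

end localCohomology

/-- If `cd(𝔞, M) ≥ 1` then the top local cohomology `H^{cd(𝔞,M)}_𝔞(M)` is not finitely
generated; consequently `f_𝔞(M) ≤ cd(𝔞, M)`. -/
theorem top_localCohomology_not_finite
    (R : Type) [CommRing R] [IsNoetherianRing R] (𝔞 : Ideal R)
    (M : Type) [AddCommGroup M] [Module R M] [Module.Finite R M]
    (h1 : (1 : WithBot ℕ∞) ≤ cohDim R 𝔞 M) :
    (∀ c : ℕ, (c : WithBot ℕ∞) = cohDim R 𝔞 M → ¬ Module.Finite R (locCoh R 𝔞 c M)) ∧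
    (finDim R 𝔞 M : WithBot ℕ∞) ≤ cohDim R 𝔞 M := by
  have key (c : ℕ) (hc : (c : WithBot ℕ∞) = cohDim R 𝔞 M) :
      ¬ Module.Finite R (locCoh R 𝔞 c M) := by
    intro hfin
    have hvan (n : ℕ) (hn : c < n) : Subsingleton (locCoh R 𝔞 n M) := by
      by_contra h
      have hle : ((n : ℕ∞) : WithBot ℕ∞) ≤ cohDim R 𝔞 M :=
        le_sSup ⟨n, rfl, not_subsingleton_iff_nontrivial.1 h⟩
      rw [← hc] at hle
      exact absurd (by exact_mod_cast hle) hn.not_ge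
    rw [← hc] at h1
    obtain ⟨c, rfl⟩ : ∃ d, c = d + 1 :=
      Nat.exists_eq_add_of_le' (by exact_mod_cast h1)
    have h0 : Subsingleton (locCoh R 𝔞 (c + 1) M) :=
      localCohomology.subsingleton_of_finite c _ M LinearMap.id Function.surjective_id rfl hfin
        fun i hi ↦ hvan (i + 1) (by lia)
    have hle : cohDim R 𝔞 M ≤ (c : ℕ∞) := by
      refine sSup_le ?_
      rintro _ ⟨n, rfl, hn⟩
      have : n ≤ c := by
        by_contra! h
        rcases Nat.lt_or_eq_of_le h with h | rfl
        · exact not_subsingleton _ (hvan n h)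
        · exact not_subsingleton _ h0
      exact_mod_cast this
    rw [← hc] at hle
    have : c + 1 ≤ c := by exact_mod_cast hle
    lia
  refine ⟨key, ?_⟩
  generalize hd : cohDim R 𝔞 M = d at *
  match d, hd with
  | ⊥, _ => simp at h1
  | (⊤ : ℕ∞), _ => exact WithBot.coe_le_coe.2 le_top
  | ((c : ℕ) : ℕ∞), _ => exact WithBot.coe_le_coe.2 (sInf_le ⟨c, rfl, key c rfl⟩)
end

section
/- Let R be a Noetherian ring, 𝔞 an ideal, and M a finitely generated R-module that is sequentially Cohen–Macaulay with respect to 𝔞, with Cohen–Macaulay filtration 0 = M_0 ⊊ M_1 ⊊ ... ⊊ M_r = M. Set c_i = cd(𝔞, M_i). Then H^{c_i}_𝔞(M) ≅ H^{c_i}_𝔞(M_i) ≅ H^{c_i}_𝔞(M_i/M_{i-1}) for i = 1,...,r, and H^k_𝔞(M) = 0 for k ∉ {c_1,...,c_r}. Moreover grade(𝔞, M_i) = grade(𝔞, M) for all i. -/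
open TensorProduct CategoryTheory DirectSum

/-- `M` is Cohen–Macaulay with respect to the ideal `I`: either `IM = M`, or
`grade(I, M) = cd(I, M)`. -/
def IsCMWrt (R : Type) [CommRing R] (I : Ideal R)
    (M : Type) [AddCommGroup M] [Module R M] : Prop :=
  I • (⊤ : Submodule R M) = ⊤ ∨ (gradeDim R I M : WithBot ℕ∞) = cohDim R I M

open Limits Opposite

lemma ShortComplex.Exact.conj {D : Type*} [Category D] [Abelian D] {A₁ A₂ A₃ B₁ B₂ B₃ : D}
    (e₁ : A₁ ≅ B₁) (e₂ : A₂ ≅ B₂) (e₃ : A₃ ≅ B₃) {f : B₁ ⟶ B₂} {g : B₂ ⟶ B₃}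
    (h : ∃ w, (ShortComplex.mk f g w).Exact) :
    ∃ w, (ShortComplex.mk (e₁.hom ≫ f ≫ e₂.inv) (e₂.hom ≫ g ≫ e₃.inv) w).Exact := by
  obtain ⟨w, h⟩ := h
  refine ⟨by simp [reassoc_of% w], ?_⟩
  exact ShortComplex.exact_of_iso (ShortComplex.isoMk e₁.symm e₂.symm e₃.symm) h

lemma epi_homologyMap_zero {D : Type*} [Category D] [Abelian D] {K L : ChainComplex D ℕ}
    (φ : K ⟶ L) [Epi φ] : Epi (HomologicalComplex.homologyMap φ 0) := by
  have hK (K : ChainComplex D ℕ) : IsIso (K.homologyι 0) :=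
    ShortComplex.isIso_homologyι (K.sc 0) (K.shape _ _ (by simp))
  have := hK K
  have := hK L
  have e : HomologicalComplex.homologyMap φ 0 =
      K.homologyι 0 ≫ HomologicalComplex.opcyclesMap φ 0 ≫ inv (L.homologyι 0) := by
    rw [← HomologicalComplex.homologyι_naturality_assoc, IsIso.hom_inv_id, Category.comp_id]
  rw [e]
  infer_instance

section DerivedSequence

variable {C D : Type*} [Category C] [Abelian C] [Category D] [Abelian D]
  {F₁ F₂ F₃ : C ⥤ D} [F₁.Additive] [F₂.Additive] [F₃.Additive]
  (α : F₁ ⟶ F₂) (β : F₂ ⟶ F₃) (w : α ≫ β = 0)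

/-- The homology in degree `n` of `F` applied to a complex `K`. -/
noncomputable abbrev homologyOfMap (F : C ⥤ D) [F.Additive] (n : ℕ) (K : ChainComplex C ℕ) : D :=
  (F.mapHomologicalComplex _ ⋙
    HomologicalComplex.homologyFunctor D (ComplexShape.down ℕ) n).obj K

/-- The short complex of chain complexes obtained by applying `F₁ ⟶ F₂ ⟶ F₃` to `K`. -/
noncomputable def complexShortComplex (K : ChainComplex C ℕ) :
    ShortComplex (ChainComplex D ℕ) :=
  ShortComplex.mk ((NatTrans.mapHomologicalComplex α _).app K)
    ((NatTrans.mapHomologicalComplex β _).app K) (by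
      ext i
      exact congr_app w (K.X i))

/-- The morphism of short complexes induced by a morphism of chain complexes. -/
noncomputable def complexShortComplexMap {K L : ChainComplex C ℕ} (φ : K ⟶ L) :
    complexShortComplex α β w K ⟶ complexShortComplex α β w L where
  τ₁ := (F₁.mapHomologicalComplex _).map φ
  τ₂ := (F₂.mapHomologicalComplex _).map φ
  τ₃ := (F₃.mapHomologicalComplex _).map φ
  comm₁₂ := (NatTrans.mapHomologicalComplex α _).naturality φ
  comm₂₃ := (NatTrans.mapHomologicalComplex β _).naturality φ

variable (h : ∀ (P : C) [Projective P],
  (ShortComplex.mk (α.app P) (β.app P) (congr_app w P)).ShortExact)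

include h in
lemma complexShortComplex_shortExact {X : C} (P : ProjectiveResolution X) :
    (complexShortComplex α β w P.complex).ShortExact :=
  HomologicalComplex.shortExact_of_degreewise_shortExact _ fun i => h (P.complex.X i)

/-- The connecting morphism of `complexShortComplex` for a projective resolution. -/
noncomputable def resolutionδ {X : C} (P : ProjectiveResolution X) (n : ℕ) :
    homologyOfMap F₃ (n + 1) P.complex ⟶ homologyOfMap F₁ n P.complex :=
  (complexShortComplex_shortExact α β w h P).δ (n + 1) n (by simp)

lemma resolutionδ_naturality {X Y : C} (P : ProjectiveResolution X) (Q : ProjectiveResolution Y)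
    (φ : P.complex ⟶ Q.complex) (n : ℕ) :
    resolutionδ α β w h P n ≫ (F₁.mapHomologicalComplex _ ⋙
      HomologicalComplex.homologyFunctor D (ComplexShape.down ℕ) n).map φ =
    (F₃.mapHomologicalComplex _ ⋙
      HomologicalComplex.homologyFunctor D (ComplexShape.down ℕ) (n + 1)).map φ ≫
        resolutionδ α β w h Q n :=
  HomologicalComplex.HomologySequence.δ_naturality (complexShortComplexMap α β w φ)
    (complexShortComplex_shortExact α β w h P) (complexShortComplex_shortExact α β w h Q)
    (n + 1) n (by simp)

variable [EnoughProjectives C]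

/-- The connecting morphism between left derived functors. -/
noncomputable def leftDerivedδ (n : ℕ) : F₃.leftDerived (n + 1) ⟶ F₁.leftDerived n where
  app X := ((projectiveResolution X).isoLeftDerivedObj F₃ (n + 1)).hom ≫
    resolutionδ α β w h (projectiveResolution X) n ≫
    ((projectiveResolution X).isoLeftDerivedObj F₁ n).inv
  naturality X Y f := by
    have comm : (ProjectiveResolution.lift f (projectiveResolution X)
        (projectiveResolution Y)).f 0 ≫ (projectiveResolution Y).π.f 0 =
          (projectiveResolution X).π.f 0 ≫ f :=
      ProjectiveResolution.lift_commutes_zero _ _ _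
    rw [ProjectiveResolution.isoLeftDerivedObj_hom_naturality_assoc f _ _ _ comm,
      Category.assoc, Category.assoc,
      ProjectiveResolution.isoLeftDerivedObj_inv_naturality f _ _ _ comm]
    congr 1
    rw [← Category.assoc, ← Category.assoc]
    congr 1
    exact (resolutionδ_naturality α β w h _ _ _ _).symm

include w h in
lemma leftDerived_exact₂ (n : ℕ) (X : C) :
    ∃ hz, (ShortComplex.mk ((NatTrans.leftDerived α n).app X)
      ((NatTrans.leftDerived β n).app X) hz).Exact := by
  rw [(projectiveResolution X).leftDerived_app_eq α n,
    (projectiveResolution X).leftDerived_app_eq β n]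
  exact ShortComplex.Exact.conj _ _ _ ⟨_,
    (complexShortComplex_shortExact α β w h (projectiveResolution X)).homology_exact₂ n⟩

lemma leftDerived_exact₃ (n : ℕ) (X : C) :
    ∃ hz, (ShortComplex.mk ((NatTrans.leftDerived β (n + 1)).app X)
      ((leftDerivedδ α β w h n).app X) hz).Exact := by
  rw [(projectiveResolution X).leftDerived_app_eq β (n + 1)]
  exact ShortComplex.Exact.conj _ _ _ ⟨_,
    (complexShortComplex_shortExact α β w h (projectiveResolution X)).homology_exact₃
      (n + 1) n (by simp)⟩

lemma leftDerived_exact₁ (n : ℕ) (X : C) :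
    ∃ hz, (ShortComplex.mk ((leftDerivedδ α β w h n).app X)
      ((NatTrans.leftDerived α n).app X) hz).Exact := by
  rw [(projectiveResolution X).leftDerived_app_eq α n]
  exact ShortComplex.Exact.conj _ _ _ ⟨_,
    (complexShortComplex_shortExact α β w h (projectiveResolution X)).homology_exact₁
      (n + 1) n (by simp)⟩

include w h in
lemma epi_leftDerived_zero (X : C) : Epi ((NatTrans.leftDerived β 0).app X) := by
  rw [(projectiveResolution X).leftDerived_app_eq β 0]
  have := (complexShortComplex_shortExact α β w h (projectiveResolution X)).epi_g
  have : Epi ((HomologicalComplex.homologyFunctor D (ComplexShape.down ℕ) 0).map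
      ((NatTrans.mapHomologicalComplex β _).app (projectiveResolution X).complex)) :=
    epi_homologyMap_zero (complexShortComplex α β w (projectiveResolution X).complex).g
  infer_instance

end DerivedSequence

lemma ShortComplex.exact_of_evaluation {J A : Type*} [Category J] [Category A] [Abelian A]
    (S : ShortComplex (J ⥤ A)) (h : ∀ j, (S.map ((evaluation J A).obj j)).Exact) : S.Exact := by
  rw [ShortComplex.exact_iff_isZero_homology, Functor.isZero_iff]
  intro j
  exact IsZero.of_iso ((ShortComplex.exact_iff_isZero_homology _).1 (h j))
    (S.mapHomologyIso ((evaluation J A).obj j)).symm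

lemma exact_colimMap {J : Type} [SmallCategory J] [IsFiltered J] {R : Type} [CommRing R]
    {F G H : J ⥤ ModuleCat.{0} R} (f : F ⟶ G) (g : G ⟶ H)
    (h : ∀ j, ∃ hz, (ShortComplex.mk (f.app j) (g.app j) hz).Exact) :
    ∃ hz, (ShortComplex.mk (colim.map f) (colim.map g) hz).Exact := by
  have hz : f ≫ g = 0 := by
    ext j : 2
    exact (h j).choose
  have hS : (ShortComplex.mk f g hz).Exact :=
    ShortComplex.exact_of_evaluation _ fun j => (h j).choose_spec
  have : PreservesFiniteLimits (colim (J := J) (C := ModuleCat.{0} R)) :=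
    HasExactColimitsOfShape.preservesFiniteLimits
  exact ⟨_, hS.map colim⟩

section ExtSequence

variable {R : Type} [CommRing R] (S : ShortComplex (ModuleCat.{0} R)) (hS : S.ShortExact)

lemma linearYoneda_map_comp :
    NatTrans.rightOp ((linearYoneda R (ModuleCat.{0} R)).map S.g) ≫
      NatTrans.rightOp ((linearYoneda R (ModuleCat.{0} R)).map S.f) = 0 := by
  ext P
  refine Quiver.Hom.unop_inj ?_
  ext (x : P ⟶ S.X₁)
  change (x ≫ S.f) ≫ S.g = 0
  simp

include hS in
lemma linearYoneda_shortExact (P : ModuleCat.{0} R) [Projective P] :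
    (ShortComplex.mk ((NatTrans.rightOp ((linearYoneda R (ModuleCat.{0} R)).map S.g)).app P)
      ((NatTrans.rightOp ((linearYoneda R (ModuleCat.{0} R)).map S.f)).app P)
      (congr_app (linearYoneda_map_comp S) P)).ShortExact := by
  have := hS.mono_f
  have := hS.epi_g
  let T : ShortComplex (ModuleCat.{0} R) :=
    ShortComplex.mk (((linearYoneda R (ModuleCat.{0} R)).map S.f).app (op P))
      (((linearYoneda R (ModuleCat.{0} R)).map S.g).app (op P)) (by
        ext (x : P ⟶ S.X₁)
        change (x ≫ S.f) ≫ S.g = 0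
        simp)
  have hT : T.ShortExact :=
    { exact := by
        rw [ShortComplex.moduleCat_exact_iff]
        intro (x : P ⟶ S.X₂) (hx : x ≫ S.g = 0)
        exact ⟨hS.exact.lift x hx, hS.exact.lift_f x hx⟩
      mono_f := by
        rw [ModuleCat.mono_iff_injective]
        intro (x : P ⟶ S.X₁) (y : P ⟶ S.X₁) (hxy : x ≫ S.f = y ≫ S.f)
        exact (cancel_mono S.f).1 hxy
      epi_g := by
        rw [ModuleCat.epi_iff_surjective]
        intro (x : P ⟶ S.X₃)
        exact ⟨Projective.factorThru x S.g, Projective.factorThru_comp x S.g⟩ }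
  exact hT.op

open localCohomology

variable {D : Type} [SmallCategory D] (I : D ⥤ Ideal R)

/-- The connecting morphism between the directed systems of `Ext` modules. -/
noncomputable def diagramδ (n : ℕ) :
    (diagram I n).flip.obj S.X₃ ⟶ (diagram I (n + 1)).flip.obj S.X₁ where
  app j := ((leftDerivedδ _ _ (linearYoneda_map_comp S)
    (fun P _ => linearYoneda_shortExact S hS P) n).app ((ringModIdeals I).obj j.unop)).unop
  naturality _ _ f := Quiver.Hom.op_inj
    ((leftDerivedδ _ _ (linearYoneda_map_comp S)
      (fun P _ => linearYoneda_shortExact S hS P) n).naturality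
        ((ringModIdeals I).map f.unop)).symm

lemma ShortComplex.Exact.exists_unop {A : Type*} [Category A] [Abelian A] {X Y Z : Aᵒᵖ}
    {f : X ⟶ Y} {g : Y ⟶ Z} (h : ∃ hz, (ShortComplex.mk f g hz).Exact) :
    ∃ hz, (ShortComplex.mk g.unop f.unop hz).Exact :=
  ⟨_, h.choose_spec.unop⟩

include hS in
lemma diagram_exact₂ (n : ℕ) (j : Dᵒᵖ) :
    ∃ hz, (ShortComplex.mk (((diagram I n).flip.map S.f).app j)
      (((diagram I n).flip.map S.g).app j) hz).Exact :=
  ShortComplex.Exact.exists_unop (leftDerived_exact₂ _ _ (linearYoneda_map_comp S)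
    (fun P _ => linearYoneda_shortExact S hS P) n ((ringModIdeals I).obj j.unop))

lemma diagram_exact₁ (n : ℕ) (j : Dᵒᵖ) :
    ∃ hz, (ShortComplex.mk ((diagramδ S hS I n).app j)
      (((diagram I (n + 1)).flip.map S.f).app j) hz).Exact :=
  ShortComplex.Exact.exists_unop (leftDerived_exact₃ _ _ (linearYoneda_map_comp S)
    (fun P _ => linearYoneda_shortExact S hS P) n ((ringModIdeals I).obj j.unop))

lemma diagram_exact₃ (n : ℕ) (j : Dᵒᵖ) :
    ∃ hz, (ShortComplex.mk (((diagram I n).flip.map S.g).app j)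
      ((diagramδ S hS I n).app j) hz).Exact :=
  ShortComplex.Exact.exists_unop (leftDerived_exact₁ _ _ (linearYoneda_map_comp S)
    (fun P _ => linearYoneda_shortExact S hS P) n ((ringModIdeals I).obj j.unop))

include hS in
lemma mono_diagram_zero : Mono ((diagram I 0).flip.map S.f) := by
  have (j : Dᵒᵖ) : Mono (((diagram I 0).flip.map S.f).app j) := by
    have := epi_leftDerived_zero _ _ (linearYoneda_map_comp S)
      (fun P _ => linearYoneda_shortExact S hS P) ((ringModIdeals I).obj j.unop)
    exact unop_mono_of_epi ((NatTrans.leftDerived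
      (NatTrans.rightOp ((linearYoneda R (ModuleCat.{0} R)).map S.f)) 0).app
        ((ringModIdeals I).obj j.unop))
  exact NatTrans.mono_of_mono_app _

end ExtSequence

section SmulVanishing

variable {R : Type*} [CommRing R]

lemma leftDerived_map_smul_id {C D : Type*} [Category C] [Abelian C] [Linear R C] [Category D]
    [Abelian D] [EnoughProjectives C] (F : C ⥤ D) [F.Additive] (s : R)
    (hs : ∀ X : C, F.map (s • 𝟙 X) = 𝟙 _) (n : ℕ) (X : C) :
    (F.leftDerived n).map (s • 𝟙 X) = 𝟙 _ := by
  rw [F.leftDerived_map_eq n (s • 𝟙 X) (P := projectiveResolution X)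
    (Q := projectiveResolution X) (s • 𝟙 _) (by
      refine HomologicalComplex.to_single_hom_ext ?_
      rw [HomologicalComplex.comp_f, HomologicalComplex.comp_f]
      erw [ChainComplex.single₀_map_f_zero]
      rw [HomologicalComplex.smul_f_apply, HomologicalComplex.id_f, Linear.smul_comp,
        Category.id_comp]
      erw [Linear.comp_smul, Category.comp_id])]
  have : (F.mapHomologicalComplex (ComplexShape.down ℕ)).map
      (s • 𝟙 (projectiveResolution X).complex) = 𝟙 _ := by
    ext i
    exact hs _
  rw [Functor.comp_map, this, CategoryTheory.Functor.map_id]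
  erw [Category.id_comp]
  exact Iso.hom_inv_id _

lemma leftDerived_map_zero {C D : Type*} [Category C] [Abelian C] [Category D]
    [Abelian D] [EnoughProjectives C] (F : C ⥤ D) [F.Additive] (n : ℕ) (X Y : C) :
    (F.leftDerived n).map (0 : X ⟶ Y) = 0 := by
  rw [F.leftDerived_map_eq n 0 (P := projectiveResolution X)
    (Q := projectiveResolution Y) 0 (by simp)]
  simp only [Functor.map_zero]
  erw [zero_comp, comp_zero]

lemma isZero_leftDerived_obj_of_smul {C D : Type*} [Category C] [Abelian C] [Linear R C]
    [Category D] [Abelian D] [EnoughProjectives C] (F : C ⥤ D) [F.Additive] (s : R)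
    (hs : ∀ X : C, F.map (s • 𝟙 X) = 𝟙 _) (n : ℕ) {X : C} (hX : s • 𝟙 X = 0) :
    IsZero ((F.leftDerived n).obj X) := by
  rw [IsZero.iff_id_eq_zero, ← leftDerived_map_smul_id F s hs n X, hX, leftDerived_map_zero]

end SmulVanishing

section LocalCohomology

open localCohomology

variable {R : Type} [CommRing R] (𝔞 : Ideal R)

/-- Local cohomology as the functor sending `M` to the colimit of its `Ext` diagram. -/
noncomputable def localCohomologyIso (n : ℕ) :
    localCohomology 𝔞 n ≅ (diagram (idealPowersDiagram 𝔞) n).flip ⋙ colim :=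
  colimitIsoFlipCompColim _

lemma isZero_ext_of_smul (s : R) (Y : ModuleCat.{0} R) (hY : s • 𝟙 Y = 𝟙 Y)
    (X : ModuleCat.{0} R) (hX : s • 𝟙 X = 0) (n : ℕ) :
    IsZero (((Ext R (ModuleCat.{0} R) n).obj (op X)).obj Y) := by
  refine (isZero_leftDerived_obj_of_smul ((linearYoneda R (ModuleCat.{0} R)).obj Y).rightOp s
    (fun Z => Quiver.Hom.unop_inj ?_) n hX).unop
  ext (x : Z ⟶ Y)
  change (s • 𝟙 Z) ≫ x = x
  rw [Linear.smul_comp, Category.id_comp, ← Category.comp_id x, ← Linear.comp_smul, hY]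

lemma isZero_localCohomology_of_smul (s : R) (hs : s ∈ 𝔞) (Y : ModuleCat.{0} R)
    (hY : s • 𝟙 Y = 𝟙 Y) (n : ℕ) : IsZero ((localCohomology 𝔞 n).obj Y) := by
  refine IsZero.of_iso ?_ ((localCohomologyIso 𝔞 n).app Y)
  have hpow (t : ℕ) : s ^ t • 𝟙 Y = 𝟙 Y := by
    induction t with
    | zero => simp
    | succ t ih => rw [pow_succ, mul_smul, hY, ih]
  refine Functor.map_isZero colim (Functor.isZero _ fun j => ?_)
  refine isZero_ext_of_smul (s ^ j.unop.unop) Y (hpow _) _ ?_ n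
  refine ModuleCat.hom_ext (LinearMap.ext fun (x : R ⧸ 𝔞 ^ j.unop.unop) => ?_)
  obtain ⟨x, rfl⟩ := Submodule.Quotient.mk_surjective _ x
  exact (Submodule.Quotient.mk_eq_zero _).2
    (Ideal.mul_mem_right x _ (Ideal.pow_mem_pow hs _))

section ShortExact

variable (S : ShortComplex (ModuleCat.{0} R)) (hS : S.ShortExact)

include hS in
lemma mono_localCohomology_map (n : ℕ)
    (h : ∀ m, m + 1 = n → IsZero ((localCohomology 𝔞 m).obj S.X₃)) :
    Mono ((localCohomology 𝔞 n).map S.f) := by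
  suffices Mono (((diagram (idealPowersDiagram 𝔞) n).flip ⋙ colim).map S.f) by
    rw [← NatIso.naturality_2 (localCohomologyIso 𝔞 n) S.f]
    infer_instance
  match n with
  | 0 =>
    have := mono_diagram_zero S hS (idealPowersDiagram 𝔞)
    exact inferInstanceAs (Mono (colim.map ((diagram (idealPowersDiagram 𝔞) 0).flip.map S.f)))
  | n + 1 =>
    obtain ⟨hz, hex⟩ := exact_colimMap _ _ (diagram_exact₁ S hS (idealPowersDiagram 𝔞) n)
    exact hex.mono_g (((h n rfl).of_iso ((localCohomologyIso 𝔞 n).app _).symm).eq_of_src _ _)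

include hS in
lemma epi_localCohomology_map (n : ℕ) (h : IsZero ((localCohomology 𝔞 (n + 1)).obj S.X₁)) :
    Epi ((localCohomology 𝔞 n).map S.g) := by
  suffices Epi (((diagram (idealPowersDiagram 𝔞) n).flip ⋙ colim).map S.g) by
    rw [← NatIso.naturality_2 (localCohomologyIso 𝔞 n) S.g]
    infer_instance
  obtain ⟨hz, hex⟩ := exact_colimMap _ _ (diagram_exact₃ S hS (idealPowersDiagram 𝔞) n)
  exact hex.epi_f ((h.of_iso ((localCohomologyIso 𝔞 (n + 1)).app _).symm).eq_of_tgt _ _)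

include hS in
lemma exact_localCohomology_map (n : ℕ) :
    ∃ hz, (ShortComplex.mk ((localCohomology 𝔞 n).map S.f)
      ((localCohomology 𝔞 n).map S.g) hz).Exact := by
  rw [← NatIso.naturality_2 (localCohomologyIso 𝔞 n) S.f,
    ← NatIso.naturality_2 (localCohomologyIso 𝔞 n) S.g]
  exact ShortComplex.Exact.conj ((localCohomologyIso 𝔞 n).app S.X₁)
    ((localCohomologyIso 𝔞 n).app S.X₂) ((localCohomologyIso 𝔞 n).app S.X₃)
    (exact_colimMap _ _ (diagram_exact₂ S hS (idealPowersDiagram 𝔞) n))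

end ShortExact

lemma subsingleton_locCoh_of_smul_top_eq_top (M : Type) [AddCommGroup M] [Module R M]
    [Module.Finite R M] (h : 𝔞 • (⊤ : Submodule R M) = ⊤) (n : ℕ) :
    Subsingleton (locCoh R 𝔞 n M) := by
  obtain ⟨s, hs, hsM⟩ := Submodule.exists_mem_and_smul_eq_self_of_fg_of_le_smul 𝔞
    (⊤ : Submodule R M) Module.Finite.fg_top h.ge
  refine ModuleCat.subsingleton_of_isZero (isZero_localCohomology_of_smul 𝔞 s hs _ ?_ n)
  exact ModuleCat.hom_ext (LinearMap.ext fun x => hsM x trivial)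

lemma isZero_localCohomology_obj {M : Type} [AddCommGroup M] [Module R M] {n : ℕ}
    (h : Subsingleton (locCoh R 𝔞 n M)) :
    IsZero ((localCohomology 𝔞 n).obj (ModuleCat.of R M)) :=
  ModuleCat.isZero_of_subsingleton (locCoh R 𝔞 n M)

/-- Local cohomology of linearly equivalent modules. -/
noncomputable def locCohCongr {M N : Type} [AddCommGroup M] [Module R M] [AddCommGroup N]
    [Module R N] (e : M ≃ₗ[R] N) (n : ℕ) : locCoh R 𝔞 n M ≃ₗ[R] locCoh R 𝔞 n N :=
  ((localCohomology 𝔞 n).mapIso e.toModuleIso).toLinearEquiv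

section Submodule

variable {𝔞} {M : Type} [AddCommGroup M] [Module R M] {N N' : Submodule R M}

/-- The short complex `N → N' → N' / N` of a pair of submodules `N ≤ N'`. -/
def submoduleShortComplex (h : N ≤ N') : ShortComplex (ModuleCat.{0} R) :=
  ShortComplex.mk (ModuleCat.ofHom (Submodule.inclusion h))
    (ModuleCat.ofHom (Submodule.comap N'.subtype N).mkQ) (by
      refine ModuleCat.hom_ext (LinearMap.ext fun x => ?_)
      exact (Submodule.Quotient.mk_eq_zero _).2 x.2)

lemma submoduleShortComplex_shortExact (h : N ≤ N') : (submoduleShortComplex h).ShortExact where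
  exact := by
    rw [ShortComplex.moduleCat_exact_iff]
    intro (x : N') hx
    exact ⟨(⟨x, (Submodule.Quotient.mk_eq_zero (Submodule.comap N'.subtype N)).1 hx⟩ : N), rfl⟩
  mono_f := (ModuleCat.mono_iff_injective _).2 (Submodule.inclusion_injective h)
  epi_g := (ModuleCat.epi_iff_surjective _).2 (Submodule.mkQ_surjective _)

lemma subsingleton_locCoh_of_le (h : N ≤ N') {n : ℕ} (h₁ : Subsingleton (locCoh R 𝔞 n N))
    (h₃ : Subsingleton (locCoh R 𝔞 n (N' ⧸ Submodule.comap N'.subtype N))) :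
    Subsingleton (locCoh R 𝔞 n N') := by
  obtain ⟨hz, hex⟩ := exact_localCohomology_map 𝔞 _ (submoduleShortComplex_shortExact h) n
  exact ModuleCat.subsingleton_of_isZero
    (hex.isZero_of_both_zeros ((isZero_localCohomology_obj 𝔞 h₁).eq_of_src _ _)
      ((isZero_localCohomology_obj 𝔞 h₃).eq_of_tgt _ _))

lemma nonempty_locCoh_equiv_of_quotient (h : N ≤ N') {n : ℕ}
    (h₃ : ∀ m, m ≤ n → Subsingleton (locCoh R 𝔞 m (N' ⧸ Submodule.comap N'.subtype N))) :
    Nonempty (locCoh R 𝔞 n N ≃ₗ[R] locCoh R 𝔞 n N') := by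
  have hS := submoduleShortComplex_shortExact h
  obtain ⟨hz, hex⟩ := exact_localCohomology_map 𝔞 _ hS n
  have := mono_localCohomology_map 𝔞 _ hS n fun m hm =>
    isZero_localCohomology_obj 𝔞 (h₃ m (by omega))
  have := hex.epi_f ((isZero_localCohomology_obj 𝔞 (h₃ n le_rfl)).eq_of_tgt _ _)
  have : IsIso ((localCohomology 𝔞 n).map (submoduleShortComplex h).f) :=
    isIso_of_mono_of_epi _
  exact ⟨(asIso ((localCohomology 𝔞 n).map (submoduleShortComplex h).f)).toLinearEquiv⟩

lemma nonempty_locCoh_equiv_quotient (h : N ≤ N') {n : ℕ}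
    (h₁ : Subsingleton (locCoh R 𝔞 n N)) (h₁' : Subsingleton (locCoh R 𝔞 (n + 1) N)) :
    Nonempty (locCoh R 𝔞 n N' ≃ₗ[R] locCoh R 𝔞 n (N' ⧸ Submodule.comap N'.subtype N)) := by
  have hS := submoduleShortComplex_shortExact h
  obtain ⟨hz, hex⟩ := exact_localCohomology_map 𝔞 _ hS n
  have := epi_localCohomology_map 𝔞 _ hS n (isZero_localCohomology_obj 𝔞 h₁')
  have := hex.mono_g ((isZero_localCohomology_obj 𝔞 h₁).eq_of_src _ _)
  have : IsIso ((localCohomology 𝔞 n).map (submoduleShortComplex h).g) :=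
    isIso_of_mono_of_epi _
  exact ⟨(asIso ((localCohomology 𝔞 n).map (submoduleShortComplex h).g)).toLinearEquiv⟩

end Submodule

section CohenMacaulay

variable {𝔞} {M : Type} [AddCommGroup M] [Module R M]

lemma le_cohDim {n : ℕ} (h : Nontrivial (locCoh R 𝔞 n M)) :
    ((n : ℕ∞) : WithBot ℕ∞) ≤ cohDim R 𝔞 M :=
  le_sSup ⟨n, rfl, h⟩

lemma gradeDim_le {n : ℕ} (h : Nontrivial (locCoh R 𝔞 n M)) : gradeDim R 𝔞 M ≤ n :=
  sInf_le ⟨n, rfl, h⟩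

lemma cohDim_eq_coe {d : ℕ} (h : Nontrivial (locCoh R 𝔞 d M))
    (hd : ∀ n, Nontrivial (locCoh R 𝔞 n M) → n ≤ d) : cohDim R 𝔞 M = ((d : ℕ∞) : WithBot ℕ∞) := by
  refine le_antisymm (sSup_le ?_) (le_cohDim h)
  rintro _ ⟨n, rfl, hn⟩
  exact_mod_cast hd n hn

lemma gradeDim_eq_coe {d : ℕ} (h : Nontrivial (locCoh R 𝔞 d M))
    (hd : ∀ n, Nontrivial (locCoh R 𝔞 n M) → d ≤ n) : gradeDim R 𝔞 M = d := by
  refine le_antisymm (gradeDim_le h) (le_sInf ?_)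
  rintro _ ⟨n, rfl, hn⟩
  exact_mod_cast hd n hn

lemma gradeDim_congr {N : Type} [AddCommGroup N] [Module R N] (e : M ≃ₗ[R] N) :
    gradeDim R 𝔞 M = gradeDim R 𝔞 N := by
  unfold gradeDim
  congr! 5
  exact and_congr_right fun _ => (locCohCongr 𝔞 e _).toEquiv.nontrivial_congr

lemma exists_nontrivial_locCoh_of_cohDim (h : 0 ≤ cohDim R 𝔞 M) :
    ∃ n, Nontrivial (locCoh R 𝔞 n M) := by
  by_contra! hn
  have : cohDim R 𝔞 M = ⊥ := by
    refine sSup_eq_bot.2 ?_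
    rintro _ ⟨n, rfl, h'⟩
    exact absurd h' (not_nontrivial_iff_subsingleton.2 (hn n))
  simp [this] at h

lemma IsCMWrt.exists_degree [Module.Finite R M] (hM : IsCMWrt R 𝔞 M) (h : 0 ≤ cohDim R 𝔞 M) :
    ∃ d : ℕ, ((d : ℕ∞) : WithBot ℕ∞) = cohDim R 𝔞 M ∧ Nontrivial (locCoh R 𝔞 d M) ∧
      ∀ k, k ≠ d → Subsingleton (locCoh R 𝔞 k M) := by
  obtain ⟨d, hd⟩ := exists_nontrivial_locCoh_of_cohDim h
  obtain hM | hM := hM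
  · exact absurd hd (not_nontrivial_iff_subsingleton.2
      (subsingleton_locCoh_of_smul_top_eq_top 𝔞 M hM d))
  have key {k l : ℕ} (hk : Nontrivial (locCoh R 𝔞 k M)) (hl : Nontrivial (locCoh R 𝔞 l M)) :
      k ≤ l := by
    have := (le_cohDim hk).trans_eq hM.symm |>.trans (WithBot.coe_le_coe.2 (gradeDim_le hl))
    exact_mod_cast this
  refine ⟨d, (cohDim_eq_coe hd fun n hn => key hn hd).symm, hd, fun k hk => ?_⟩
  rw [← not_nontrivial_iff_subsingleton]
  exact fun hk' => hk (le_antisymm (key hk' hd) (key hd hk'))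

end CohenMacaulay

section Filtration

variable {𝔞} {M : Type} [AddCommGroup M] [Module R M] {r : ℕ} {F : Fin (r + 1) → Submodule R M}
  (h0 : F 0 = ⊥) (hF : Monotone F) {d : Fin r → ℕ} (hd : StrictMono d)
  (hQ : ∀ i k, k ≠ d i →
    Subsingleton (locCoh R 𝔞 k (F i.succ ⧸ Submodule.comap (F i.succ).subtype (F i.castSucc))))

include h0 hF hQ in
lemma subsingleton_locCoh_filtration (i : Fin (r + 1)) (k : ℕ)
    (hk : ∀ j : Fin r, j.castSucc < i → k ≠ d j) : Subsingleton (locCoh R 𝔞 k (F i)) := by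
  induction i using Fin.induction with
  | zero =>
    have : Subsingleton (F 0) := by rw [h0]; infer_instance
    exact subsingleton_locCoh_of_smul_top_eq_top 𝔞 _ (Subsingleton.elim _ _) k
  | succ i ih =>
    exact subsingleton_locCoh_of_le (hF i.castSucc_lt_succ.le)
      (ih fun j hj => hk j (hj.trans i.castSucc_lt_succ)) (hQ i k (hk i i.castSucc_lt_succ))

include h0 hF hd hQ in
lemma nonempty_locCoh_filtration_equiv_quotient (i : Fin r) :
    Nonempty (locCoh R 𝔞 (d i) (F i.succ) ≃ₗ[R]
      locCoh R 𝔞 (d i) (F i.succ ⧸ Submodule.comap (F i.succ).subtype (F i.castSucc))) := by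
  have hlt (j : Fin r) (hj : j.castSucc < i.castSucc) : d j < d i := hd hj
  exact nonempty_locCoh_equiv_quotient (hF i.castSucc_lt_succ.le)
    (subsingleton_locCoh_filtration h0 hF hQ _ _ fun j hj => (hlt j hj).ne')
    (subsingleton_locCoh_filtration h0 hF hQ _ _ fun j hj => ((hlt j hj).trans (lt_add_one _)).ne')

include hF hd hQ in
lemma nonempty_locCoh_filtration_equiv (i : Fin r) (m : Fin (r + 1)) (h : i.succ ≤ m) :
    Nonempty (locCoh R 𝔞 (d i) (F i.succ) ≃ₗ[R] locCoh R 𝔞 (d i) (F m)) := by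
  induction m using Fin.induction with
  | zero => exact absurd h (by simp)
  | succ j ih =>
    obtain h | h := h.eq_or_lt
    · rw [h]
      exact ⟨LinearEquiv.refl R _⟩
    · have hij : i < j := Fin.succ_lt_succ_iff.1 h
      obtain ⟨e⟩ := ih (Fin.le_def.2 (by simpa using hij))
      obtain ⟨e'⟩ := nonempty_locCoh_equiv_of_quotient (hF j.castSucc_lt_succ.le) (n := d i)
        fun m hm => hQ j m (hm.trans_lt (hd hij)).ne
      exact ⟨e.trans e'⟩

end Filtration

end LocalCohomology

/-- For a sequentially Cohen–Macaulay module with Cohen–Macaulay filtration `F`, with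
`c i = cd(𝔞, F i)`: `H^{c i}_𝔞(M) ≅ H^{c i}_𝔞(F i) ≅ H^{c i}_𝔞(F i / F (i-1))`, the local
cohomology of `M` vanishes away from the `c i`, and `grade(𝔞, F i) = grade(𝔞, M)` for all
`i ≥ 1`. -/
theorem seqCM_filtration_localCohomology
    (R : Type) [CommRing R] [IsNoetherianRing R] (𝔞 : Ideal R)
    (M : Type) [AddCommGroup M] [Module R M] [Module.Finite R M]
    (r : ℕ) (F : Fin (r + 1) → Submodule R M)
    (h0 : F 0 = ⊥) (htop : F (Fin.last r) = ⊤) (hmono : StrictMono F)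
    (hCM : ∀ i : Fin r,
      IsCMWrt R 𝔞 (↥(F i.succ) ⧸ Submodule.comap (F i.succ).subtype (F i.castSucc)))
    (hpos : ∀ i : Fin r, (0 : WithBot ℕ∞) ≤
      cohDim R 𝔞 (↥(F i.succ) ⧸ Submodule.comap (F i.succ).subtype (F i.castSucc)))
    (hinc : StrictMono (fun i : Fin r =>
      cohDim R 𝔞 (↥(F i.succ) ⧸ Submodule.comap (F i.succ).subtype (F i.castSucc)))) :
    (∀ (i : Fin r) (c : ℕ), (c : WithBot ℕ∞) = cohDim R 𝔞 ↥(F i.succ) →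
      Nonempty ((locCoh R 𝔞 c M) ≃ₗ[R] (locCoh R 𝔞 c ↥(F i.succ))) ∧
      Nonempty ((locCoh R 𝔞 c M) ≃ₗ[R]
        (locCoh R 𝔞 c (↥(F i.succ) ⧸ Submodule.comap (F i.succ).subtype (F i.castSucc))))) ∧
    (∀ n : ℕ, (∀ i : Fin r, (n : WithBot ℕ∞) ≠ cohDim R 𝔞 ↥(F i.succ)) →
      Subsingleton (locCoh R 𝔞 n M)) ∧
    (∀ i : Fin r, gradeDim R 𝔞 ↥(F i.succ) = gradeDim R 𝔞 M) := by
  have hex (i : Fin r) := (hCM i).exists_degree (hpos i)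
  choose d hdc hdn hQ using hex
  have hd : StrictMono d := fun i j hij => by
    have := hinc hij
    simp only [← hdc] at this
    exact_mod_cast this
  have hvan := subsingleton_locCoh_filtration h0 hmono.monotone hQ
  have hquot := nonempty_locCoh_filtration_equiv_quotient h0 hmono.monotone hd hQ
  have hequiv := nonempty_locCoh_filtration_equiv hmono.monotone hd hQ
  have hnt (i : Fin r) (m : Fin (r + 1)) (h : i.succ ≤ m) :
      Nontrivial (locCoh R 𝔞 (d i) (F m)) := by
    obtain ⟨e⟩ := hequiv i m h
    obtain ⟨e'⟩ := hquot i
    have := hdn i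
    exact (e.symm.trans e').toEquiv.nontrivial
  have hdeg (m : Fin (r + 1)) (n : ℕ) (hn : Nontrivial (locCoh R 𝔞 n (F m))) :
      ∃ j : Fin r, j.castSucc < m ∧ n = d j := by
    by_contra! hj
    exact not_subsingleton_iff_nontrivial.2 hn (hvan m n hj)
  have hcd (i : Fin r) : cohDim R 𝔞 (F i.succ) = ((d i : ℕ∞) : WithBot ℕ∞) := by
    refine cohDim_eq_coe (hnt i _ le_rfl) fun n hn => ?_
    obtain ⟨j, hj, rfl⟩ := hdeg _ n hn
    exact hd.monotone (Fin.castSucc_lt_succ_iff.1 hj)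
  let eM : F (Fin.last r) ≃ₗ[R] M := LinearEquiv.ofTop _ htop
  refine ⟨fun i c hc => ?_, fun n hn => ?_, fun i => ?_⟩
  · obtain rfl : c = d i := by
      rw [hcd] at hc
      exact_mod_cast hc
    obtain ⟨e⟩ := hequiv i (Fin.last r) (Fin.le_last _)
    obtain ⟨e'⟩ := hquot i
    have e₁ := (locCohCongr 𝔞 eM (d i)).symm.trans e.symm
    exact ⟨⟨e₁⟩, ⟨e₁.trans e'⟩⟩
  · have := hvan (Fin.last r) n fun j _ hj => hn j (by rw [hcd, hj]; rfl)
    exact (locCohCongr 𝔞 eM n).symm.toEquiv.subsingleton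
  · rw [← gradeDim_congr eM]
    have hr : 0 < r := i.pos
    have hgr (m : Fin (r + 1)) (hm : Fin.succ ⟨0, hr⟩ ≤ m) :
        gradeDim R 𝔞 (F m) = d ⟨0, hr⟩ := by
      refine gradeDim_eq_coe (hnt _ m hm) fun n hn => ?_
      obtain ⟨j, _, rfl⟩ := hdeg _ n hn
      exact hd.monotone (Fin.le_def.2 (Nat.zero_le _))
    rw [hgr _ (Fin.succ_le_succ_iff.2 (Fin.le_def.2 (Nat.zero_le _))), hgr _ (Fin.le_last _)]
end
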